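/- Suppose λ₀ ∈ ρ(T), i.e. T(λ₀) : dom A → H is bijective with bounded inverse T(λ₀)⁻¹, and suppose the operator B∘T(λ₀)⁻¹ : H → H is bounded. Then for every λ ∈ ℂ the operator T(λ) : dom A → H is bijective with bounded inverse if and only if the bounded operator I + (λ−λ₀)² T(λ₀)⁻¹ + (λ−λ₀)(2λ₀ T(λ₀)⁻¹ − B∘T(λ₀)⁻¹) on H is bijective with bounded inverse. -/

import Mathlib

noncomputable section

variable {H : Type} [NormedAddCommGroup H] [InnerProductSpace ℂ H] [CompleteSpace H]

/-- The quadratic operator pencil `T(λ) y = λ² y − λ (B y) − A y` on `dom A`. -/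
def pencilApply (A B : H →ₗ.[ℂ] H) (hAB : A.domain ≤ B.domain) (l : ℂ) (y : A.domain) : H :=
  l ^ 2 • (y : H) - l • B (Submodule.inclusion hAB y) - A y

/-- `λ ∈ ρ(T)`: `T(λ) : dom A → H` is bijective with bounded inverse. -/
def InResolvent (A B : H →ₗ.[ℂ] H) (hAB : A.domain ≤ B.domain) (l : ℂ) : Prop :=
  Function.Bijective (pencilApply A B hAB l) ∧
    ∃ C : ℝ, ∀ y : A.domain, ‖(y : H)‖ ≤ C * ‖pencilApply A B hAB l y‖

/-- `T(λ) T(λ₀)⁻¹ = I + (λ−λ₀)² T(λ₀)⁻¹ + (λ−λ₀)(2λ₀ T(λ₀)⁻¹ − B T(λ₀)⁻¹)`. -/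
theorem pencilApply_comp_inverse {E : Type} [NormedAddCommGroup E]
    [InnerProductSpace ℂ E] (A B : E →ₗ.[ℂ] E) (hAB : A.domain ≤ B.domain)
    (l₀ : ℂ) (S : E →L[ℂ] E) (hS_mem : ∀ z : E, S z ∈ A.domain)
    (hS_right : ∀ z : E, pencilApply A B hAB l₀ ⟨S z, hS_mem z⟩ = z)
    (BS : E →L[ℂ] E) (hBS : ∀ z : E, BS z = B ⟨S z, hAB (hS_mem z)⟩) (l : ℂ) (z : E) :
    pencilApply A B hAB l ⟨S z, hS_mem z⟩ =
      (1 + (l - l₀) ^ 2 • S + (l - l₀) • ((2 * l₀) • S - BS)) z := by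
  have hB : B (Submodule.inclusion hAB ⟨S z, hS_mem z⟩) = BS z := (hBS z).symm
  have h₀ := hS_right z
  simp only [pencilApply, hB] at h₀ ⊢
  simp only [add_apply, sub_apply, smul_apply, one_apply_eq_self]
  rw [sub_eq_iff_eq_add] at h₀
  rw [sub_eq_iff_eq_add]
  linear_combination (norm := module) h₀

/-- If `λ₀ ∈ ρ(T)` with bounded inverse `S = T(λ₀)⁻¹` and `B ∘ T(λ₀)⁻¹` is bounded, then
`T(λ) : dom A → H` is bijective with bounded inverse iff the bounded operator
`I + (λ−λ₀)² T(λ₀)⁻¹ + (λ−λ₀)(2λ₀ T(λ₀)⁻¹ − B T(λ₀)⁻¹)` is bijective with bounded inverse. -/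
theorem pencil_resolvent_via_bounded_pencil (A B : H →ₗ.[ℂ] H) (hAB : A.domain ≤ B.domain)
    (l₀ : ℂ) (S : H →L[ℂ] H) (hS_mem : ∀ z : H, S z ∈ A.domain)
    (hS_left : ∀ y : A.domain, S (pencilApply A B hAB l₀ y) = (y : H))
    (hS_right : ∀ z : H, pencilApply A B hAB l₀ ⟨S z, hS_mem z⟩ = z)
    (BS : H →L[ℂ] H)
    (hBS : ∀ z : H, BS z = B ⟨S z, hAB (hS_mem z)⟩) :
    ∀ l : ℂ, InResolvent A B hAB l ↔
      ∃ U : H →L[ℂ] H,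
        (∀ z : H, U ((1 + (l - l₀) ^ 2 • S + (l - l₀) • ((2 * l₀) • S - BS)) z) = z) ∧
        (∀ z : H, (1 + (l - l₀) ^ 2 • S + (l - l₀) • ((2 * l₀) • S - BS)) (U z) = z) := by
  intro l
  set M : H →L[ℂ] H := 1 + (l - l₀) ^ 2 • S + (l - l₀) • ((2 * l₀) • S - BS)
  have key : ∀ z, pencilApply A B hAB l ⟨S z, hS_mem z⟩ = M z :=
    pencilApply_comp_inverse A B hAB l₀ S hS_mem hS_right BS hBS l
  have hSbij : Function.Bijective (fun z : H => (⟨S z, hS_mem z⟩ : A.domain)) :=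
    Function.bijective_iff_has_inverse.mpr
      ⟨pencilApply A B hAB l₀, hS_right, fun y => Subtype.ext (hS_left y)⟩
  have hcomp : ⇑M = pencilApply A B hAB l ∘ fun z : H => (⟨S z, hS_mem z⟩ : A.domain) :=
    funext fun z => (key z).symm
  have hbij : Function.Bijective M ↔ Function.Bijective (pencilApply A B hAB l) := by
    rw [hcomp]
    exact Function.Bijective.of_comp_iff _ hSbij
  constructor
  · rintro ⟨hT, -⟩
    have hMb := hbij.mpr hT
    let e := ContinuousLinearEquiv.ofBijective M
      (LinearMap.ker_eq_bot.mpr hMb.1) (LinearMap.range_eq_top.mpr hMb.2)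
    exact ⟨e.symm, e.symm_apply_apply, e.apply_symm_apply⟩
  · rintro ⟨U, hUM, hMU⟩
    refine ⟨hbij.mp (Function.bijective_iff_has_inverse.mpr ⟨U, hUM, hMU⟩), ‖S.comp U‖,
      fun y => ?_⟩
    obtain ⟨z, rfl⟩ := hSbij.2 y
    have h := (S.comp U).le_opNorm (M z)
    rw [ContinuousLinearMap.comp_apply, hUM] at h
    simpa only [key] using h
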